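/- Let A be a regular local ring, let f be an element of the maximal ideal m_A with f ∉ m_A², and let d ≥ 1 and N ≥ 1 be integers. Let α be an N×N matrix over A satisfying α^d = f · I_N. Then d divides N, the map α : A^N → A^N is injective, its cokernel M is a nonzero A-module annihilated by f, and M, viewed canonically as a module over B = A/(f), is a free B-module of rank N/d. -/

import Mathlib

open IsLocalRing

theorem isDomain_of_regular_aux (n : ℕ) : ∀ (A : Type*) [CommRing A] [IsLocalRing A]
    [IsNoetherianRing A] (s : Finset A), Ideal.span (s : Set A) = maximalIdeal A →
    s.card ≤ n → (n : WithBot ℕ∞) ≤ ringKrullDim A → IsDomain A := by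
  classical
  induction n with
  | zero =>
    intro A _ _ _ s hs hc _
    have : s = ∅ := by simpa using hc
    subst this
    have h : maximalIdeal A = ⊥ := by rw [← hs]; simp
    exact (isField_iff_maximalIdeal_eq.mpr h).isDomain
  | succ n ih =>
    intro A _ _ _ s hs hc hdim
    have hpos : ∀ p ∈ minimalPrimes A, ¬ maximalIdeal A ≤ p := by
      intro p hp hle
      have hpp : p.IsPrime := hp.1.1
      have : p = maximalIdeal A := le_antisymm (le_maximalIdeal hpp.ne_top) hle
      subst this
      have h0 : (maximalIdeal A).height = 0 := Ideal.height_eq_zero_iff.mpr hp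
      rw [← maximalIdeal_height_eq_ringKrullDim, h0] at hdim
      have : ((n + 1 : ℕ) : WithBot ℕ∞) ≤ ((0 : ℕ) : WithBot ℕ∞) := by
        simpa only [Nat.cast_zero, WithBot.coe_zero] using hdim
      rw [Nat.cast_le] at this
      omega
    have hfin : (minimalPrimes A).Finite := minimalPrimes.finite_of_isNoetherianRing A
    obtain ⟨x, hxm, hx2, hxp⟩ : ∃ x ∈ maximalIdeal A, x ∉ (maximalIdeal A) ^ 2 ∧
        ∀ p ∈ minimalPrimes A, x ∉ p := by
      by_contra! hcon
      have := (Ideal.subset_union_prime (s := insert ((maximalIdeal A) ^ 2) hfin.toFinset)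
        (f := id) ((maximalIdeal A) ^ 2) ((maximalIdeal A) ^ 2) (I := maximalIdeal A) (by
          intro i hi h1 _
          rcases Finset.mem_insert.mp hi with h | h
          · exact absurd h h1
          · exact ((hfin.mem_toFinset).mp h).1.1)).mp (by
          intro x hx
          simp only [Set.mem_iUnion]
          by_cases hx2 : x ∈ (maximalIdeal A) ^ 2
          · exact ⟨_, by simp, hx2⟩
          · obtain ⟨p, hp, hxp⟩ := hcon x hx hx2
            exact ⟨p, by simp [hp], hxp⟩)
      obtain ⟨i, hi, hle⟩ := this
      rcases Finset.mem_insert.mp hi with h | h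
      · subst h
        have hbot : maximalIdeal A = ⊥ := by
          refine Submodule.eq_bot_of_le_smul_of_le_jacobson_bot (maximalIdeal A) _
            (IsNoetherian.noetherian _) ?_ (maximalIdeal_le_jacobson _)
          simpa [pow_two] using hle
        obtain ⟨p, hp, -⟩ := Ideal.exists_minimalPrimes_le (bot_le : (⊥ : Ideal A) ≤ maximalIdeal A)
        exact hpos p hp (by rw [hbot]; exact bot_le)
      · exact hpos i ((hfin.mem_toFinset).mp h) hle
    -- exchange
    obtain ⟨a, ha⟩ : ∃ a : A → A, ∑ i ∈ s, a i * i = x := by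
      rw [← hs] at hxm
      obtain ⟨a, -, ha⟩ := Submodule.mem_span_finset.mp hxm
      exact ⟨a, by simpa using ha⟩
    obtain ⟨i, his, hi⟩ : ∃ i ∈ s, IsUnit (a i) := by
      by_contra! hcon
      apply hx2
      rw [← ha, pow_two]
      refine Ideal.sum_mem _ fun i hi => Ideal.mul_mem_mul (hcon i hi) ?_
      rw [← hs]; exact Ideal.subset_span hi
    let I := Ideal.span ({x} : Set A)
    have hI : I ≤ maximalIdeal A := by
      rw [Ideal.span_le]; simpa using hxm
    have hIt : I ≠ ⊤ := fun h => (maximalIdeal.isMaximal A).ne_top (top_le_iff.mp (h ▸ hI))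
    have : Nontrivial (A ⧸ I) := Ideal.Quotient.nontrivial_iff.mpr hIt
    have : IsLocalRing (A ⧸ I) :=
      IsLocalRing.of_surjective' (Ideal.Quotient.mk I) Ideal.Quotient.mk_surjective
    have hmap : maximalIdeal (A ⧸ I) = (maximalIdeal A).map (Ideal.Quotient.mk I) :=
      (IsLocalRing.map_maximalIdeal_of_surjective _ Ideal.Quotient.mk_surjective).symm
    have hdom : IsDomain (A ⧸ I) := by
      refine ih (A ⧸ I) ((s.erase i).image (Ideal.Quotient.mk I)) ?_ ?_ ?_
      · rw [hmap, Finset.coe_image, ← Ideal.map_span]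
        apply le_antisymm
        · refine Ideal.map_mono ?_
          rw [← hs]
          exact Ideal.span_mono (by simp)
        · rw [← hs, Ideal.map_span, Ideal.span_le]
          rintro _ ⟨y, hy, rfl⟩
          by_cases hyi : y = i
          · subst hyi
            have h0 : (Ideal.Quotient.mk I) x = 0 :=
              Ideal.Quotient.eq_zero_iff_mem.mpr (Ideal.mem_span_singleton_self x)
            rw [← ha, ← Finset.add_sum_erase _ _ his, map_add, map_mul] at h0
            have h1 : (Ideal.Quotient.mk I) (a y) * (Ideal.Quotient.mk I) y ∈
                (Ideal.span ((s.erase y : Finset A) : Set A)).map (Ideal.Quotient.mk I) := by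
              rw [eq_neg_of_add_eq_zero_left h0]
              refine neg_mem (Ideal.mem_map_of_mem _ ?_)
              exact Ideal.sum_mem _ fun j hj => Ideal.mul_mem_left _ _ (Ideal.subset_span hj)
            exact (Ideal.unit_mul_mem_iff_mem _ (hi.map _)).mp h1
          · exact Ideal.mem_map_of_mem _ (Ideal.subset_span (by simpa [hyi] using hy))
      · refine Finset.card_image_le.trans ?_
        rw [Finset.card_erase_of_mem his]; omega
      · have := ringKrullDim_le_ringKrullDim_quotient_add_card ({x} : Finset A) (by
          rw [IsLocalRing.ringJacobson_eq_maximalIdeal]; simpa using hxm)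
        have h2 := hdim.trans this
        rw [Finset.coe_singleton, Finset.card_singleton] at h2
        change _ ≤ ringKrullDim (A ⧸ I) + _ at h2
        push_cast at h2
        generalize ringKrullDim (A ⧸ I) = t at h2
        exact (ENat.WithBot.add_le_add_one_right_iff).mp h2
    have hIp : I.IsPrime := (Ideal.Quotient.isDomain_iff_prime I).mp hdom
    obtain ⟨q, hq, hqI⟩ := Ideal.exists_minimalPrimes_le (bot_le : (⊥ : Ideal A) ≤ I)
    have hqp : q.IsPrime := hq.1.1
    have hqbot : q = ⊥ := by
      refine Submodule.eq_bot_of_le_smul_of_le_jacobson_bot (maximalIdeal A) _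
            (IsNoetherian.noetherian _) ?_ (maximalIdeal_le_jacobson _)
      intro y hy
      obtain ⟨z, rfl⟩ := Ideal.mem_span_singleton'.mp (hqI hy)
      have hz : z ∈ q := (hqp.mem_or_mem hy).resolve_right (hxp q hq)
      rw [mul_comm]
      exact Ideal.mul_mem_mul hxm hz
    subst hqbot
    exact (IsDomain.of_bot_isPrime A)

theorem finrank_eq_of_ker_le {k V : Type*} [Field k] [AddCommGroup V] [Module k V]
    [FiniteDimensional k V] (a : V →ₗ[k] V) (d : ℕ) (hd : 1 ≤ d) (h0 : a ^ d = 0)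
    (hk : LinearMap.ker a ≤ LinearMap.range (a ^ (d - 1))) :
    Module.finrank k V = d * Module.finrank k (LinearMap.ker a) := by
  have key : ∀ i ≤ d, Module.finrank k (LinearMap.range (a ^ i)) +
      i * Module.finrank k (LinearMap.ker a) = Module.finrank k V := by
    intro i
    induction i with
    | zero =>
      intro _
      rw [pow_zero, Module.End.one_eq_id, LinearMap.range_id, finrank_top, zero_mul, add_zero]
    | succ i ih =>
      intro hi
      have h1 := ih (by omega)
      have hle : LinearMap.ker a ≤ LinearMap.range (a ^ i) := by
        refine hk.trans ?_
        obtain ⟨j, hj⟩ := Nat.exists_eq_add_of_le (show i ≤ d - 1 by omega)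
        rw [hj, pow_add]
        exact LinearMap.range_comp_le_range _ _
      have h2 := LinearMap.finrank_range_add_finrank_ker (a.domRestrict (LinearMap.range (a ^ i)))
      have h3 : LinearMap.range (a.domRestrict (LinearMap.range (a ^ i))) =
          LinearMap.range (a ^ (i + 1)) := by
        rw [LinearMap.range_domRestrict, pow_succ', Module.End.mul_eq_comp, LinearMap.range_comp]
      have h4 : Module.finrank k (LinearMap.ker (a.domRestrict (LinearMap.range (a ^ i)))) =
          Module.finrank k (LinearMap.ker a) := by
        rw [LinearMap.ker_domRestrict]
        exact (Submodule.comapSubtypeEquivOfLe hle).finrank_eq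
      rw [h3, h4] at h2
      rw [← h1, ← h2]; ring
  have := key d le_rfl
  rw [h0, LinearMap.range_zero, finrank_bot, zero_add] at this
  exact this.symm

theorem ker_le_range_residue {A : Type*} [CommRing A] [IsLocalRing A] {N : ℕ} (f : A)
    (hf2 : f ∉ maximalIdeal A ^ 2) (α β : Matrix (Fin N) (Fin N) A)
    (h : α * β = f • (1 : Matrix (Fin N) (Fin N) A)) :
    LinearMap.ker (β.map (residue A)).mulVecLin ≤ LinearMap.range (α.map (residue A)).mulVecLin := by
  intro v hv
  by_contra hcon
  obtain ⟨φ, hφ0, hφ⟩ := Submodule.exists_le_ker_of_notMem hcon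
  obtain ⟨e, rfl⟩ : ∃ e : Fin N → A, residue A ∘ e = v :=
    (residue_surjective (R := A)).comp_left v
  obtain ⟨p, hp⟩ : ∃ p : Fin N → A, ∀ i, residue A (p i) = φ (Pi.single i 1) :=
    ⟨fun i => (residue_surjective (R := A) (φ (Pi.single i 1))).choose,
      fun i => (residue_surjective (R := A) (φ (Pi.single i 1))).choose_spec⟩
  have hdot : ∀ w : Fin N → A, residue A (p ⬝ᵥ w) = φ (residue A ∘ w) := by
    intro w
    rw [LinearMap.pi_apply_eq_sum_univ φ]
    simp only [dotProduct, map_sum, map_mul, hp, Function.comp, smul_eq_mul]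
    refine Finset.sum_congr rfl fun i _ => ?_
    rw [mul_comm]
    congr 2
    ext j; simp [Pi.single_apply, eq_comm]
  have h1 : ∀ i, (Matrix.vecMul p α) i ∈ maximalIdeal A := by
    intro i
    rw [← residue_eq_zero_iff]
    change residue A (p ⬝ᵥ fun j => α j i) = 0
    rw [hdot]
    refine hφ ⟨Pi.single i 1, ?_⟩
    ext j
    simp
  have h2 : ∀ i, (Matrix.mulVec β e) i ∈ maximalIdeal A := by
    intro i
    rw [← residue_eq_zero_iff]
    have := congrFun (LinearMap.mem_ker.mp hv) i
    rw [RingHom.map_mulVec]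
    exact this
  have h3 : f * (p ⬝ᵥ e) = (Matrix.vecMul p α) ⬝ᵥ (Matrix.mulVec β e) := by
    rw [← Matrix.dotProduct_mulVec, Matrix.mulVec_mulVec, h, Matrix.smul_mulVec, Matrix.one_mulVec,
      dotProduct_smul, smul_eq_mul]
  have h4 : f * (p ⬝ᵥ e) ∈ maximalIdeal A ^ 2 := by
    rw [h3, pow_two]
    exact Ideal.sum_mem _ fun i _ => Ideal.mul_mem_mul (h1 i) (h2 i)
  have h5 : IsUnit (p ⬝ᵥ e) := by
    rw [← residue_ne_zero_iff_isUnit, hdot]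
    exact hφ0
  exact hf2 ((Ideal.mul_unit_mem_iff_mem _ h5).mp h4)

theorem exists_left_inverse_of_residue {A : Type*} [CommRing A] [IsLocalRing A] {N b : ℕ}
    (G : Matrix (Fin N) (Fin b) A)
    (hG : Function.Injective (G.map (residue A)).mulVecLin) :
    ∃ H : Matrix (Fin b) (Fin N) A, H * G = 1 := by
  obtain ⟨g, hg⟩ := LinearMap.exists_leftInverse_of_injective _ (LinearMap.ker_eq_bot.mpr hG)
  have hg' : LinearMap.toMatrix' g * G.map (residue A) = 1 := by
    have := congrArg LinearMap.toMatrix' hg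
    rw [LinearMap.toMatrix'_comp, LinearMap.toMatrix'_id] at this
    rw [← this]
    congr 1
    exact (LinearMap.toMatrix'_toLin' _).symm
  obtain ⟨H, hH⟩ : ∃ H : Matrix (Fin b) (Fin N) A, H.map (residue A) = LinearMap.toMatrix' g := by
    choose c hc using residue_surjective (R := A)
    exact ⟨(LinearMap.toMatrix' g).map c, by ext i j; simp [hc]⟩
  have hu : IsUnit (H * G).det := by
    rw [← residue_ne_zero_iff_isUnit, RingHom.map_det, RingHom.mapMatrix_apply, Matrix.map_mul,
      hH, hg']
    simp
  exact ⟨(H * G)⁻¹ * H, by rw [Matrix.mul_assoc, Matrix.nonsing_inv_mul _ hu]⟩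

theorem coker_equiv {A : Type*} [CommRing A] [IsLocalRing A] {N : ℕ} (f : A)
    (hf2 : f ∉ maximalIdeal A ^ 2) (α β : Matrix (Fin N) (Fin N) A)
    (h : α * β = f • (1 : Matrix (Fin N) (Fin N) A))
    (h' : β * α = f • (1 : Matrix (Fin N) (Fin N) A)) (b : ℕ)
    (hb : Module.finrank (ResidueField A) (LinearMap.ker (α.map (residue A)).mulVecLin) = b) :
    Nonempty (((Fin N → A) ⧸ LinearMap.range α.mulVecLin) ≃ₗ[A]
      (Fin b → A ⧸ Ideal.span {f})) := by
  obtain ⟨C, hC⟩ := Submodule.exists_isCompl (LinearMap.range (α.map (residue A)).mulVecLin)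
  have hCb : Module.finrank (ResidueField A) C = b := by
    have h1 := Submodule.finrank_add_eq_of_isCompl hC
    have h2 := LinearMap.finrank_range_add_finrank_ker (α.map (residue A)).mulVecLin
    omega
  let c := Module.finBasisOfFinrankEq (ResidueField A) C hCb
  obtain ⟨E, hE⟩ : ∃ E : Matrix (Fin N) (Fin b) A, ∀ i j, residue A (E i j) = (c j : Fin N → _) i := by
    choose l hl using residue_surjective (R := A)
    exact ⟨fun i j => l ((c j : Fin N → _) i), fun i j => hl _⟩
  have hEv : ∀ w : Fin b → ResidueField A, (E.map (residue A)).mulVec w =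
      ((∑ j, w j • c j : C) : Fin N → ResidueField A) := by
    intro w
    ext i
    simp [Matrix.mulVec, dotProduct, hE, mul_comm]
  have hinj : Function.Injective ((β * E).map (residue A)).mulVecLin := by
    rw [← LinearMap.ker_eq_bot, LinearMap.ker_eq_bot']
    intro w hw
    rw [Matrix.mulVecLin_apply, Matrix.map_mul, ← Matrix.mulVec_mulVec] at hw
    have h1 := ker_le_range_residue f hf2 α β h (LinearMap.mem_ker.mpr hw)
    have h2 : (E.map (residue A)).mulVec w ∈ C := by rw [hEv]; exact Subtype.property _
    have h3 := (Submodule.disjoint_def.mp hC.disjoint) _ h1 h2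
    rw [hEv] at h3
    have h4 : ∑ j, w j • c j = 0 := Subtype.ext h3
    funext j
    exact Fintype.linearIndependent_iff.mp c.linearIndependent w h4 j
  obtain ⟨H, hH⟩ := exists_left_inverse_of_residue _ hinj
  let φ : (Fin b → A) →ₗ[A] ((Fin N → A) ⧸ LinearMap.range α.mulVecLin) :=
    (LinearMap.range α.mulVecLin).mkQ ∘ₗ E.mulVecLin
  let ψ : (Fin b → A) →ₗ[A] (Fin b → A ⧸ Ideal.span {f}) :=
    LinearMap.pi fun j => (Ideal.span {f}).mkQ ∘ₗ LinearMap.proj j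
  have hψ : Function.Surjective ψ := by
    intro y
    choose l hl using Submodule.mkQ_surjective (Ideal.span {f})
    exact ⟨fun j => l (y j), funext fun j => hl _⟩
  have htop : (LinearMap.range E.mulVecLin) ⊔ LinearMap.range α.mulVecLin = ⊤ := by
    rw [eq_top_iff]
    refine Submodule.le_of_le_smul_of_le_jacobson_bot (I := maximalIdeal A)
      (Module.Finite.fg_top) (maximalIdeal_le_jacobson _) ?_
    intro v _
    have hv : residue A ∘ v ∈ C ⊔ LinearMap.range (α.map (residue A)).mulVecLin := by
      rw [sup_comm, hC.sup_eq_top]; trivial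
    obtain ⟨x, hx, _, ⟨y, rfl⟩, hxy⟩ := Submodule.mem_sup.mp hv
    obtain ⟨y, rfl⟩ := (residue_surjective (R := A)).comp_left y
    obtain ⟨w, hw⟩ := (residue_surjective (R := A)).comp_left (c.repr ⟨x, hx⟩)
    have hx' : (E.map (residue A)).mulVec (residue A ∘ w) = x := by
      rw [hEv]
      have h5 := c.sum_repr ⟨x, hx⟩
      have : ∀ j, (residue A ∘ w) j = c.repr ⟨x, hx⟩ j := fun j => congrFun hw j
      simp only [this, h5]
    have hd : ∀ i, (v - (E.mulVec w + α.mulVec y)) i ∈ maximalIdeal A := by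
      intro i
      rw [← residue_eq_zero_iff]
      have := congrFun hxy i
      rw [← hx'] at this
      simp only [Pi.sub_apply, Pi.add_apply, map_sub, map_add, RingHom.map_mulVec]
      rw [sub_eq_zero]
      exact this.symm
    have : v = (E.mulVec w + α.mulVec y) + (v - (E.mulVec w + α.mulVec y)) := by abel
    rw [this]
    refine Submodule.add_mem_sup (Submodule.add_mem_sup ⟨w, rfl⟩ ⟨y, rfl⟩) ?_
    generalize v - (E.mulVec w + α.mulVec y) = z at hd
    rw [pi_eq_sum_univ z]
    exact Submodule.sum_mem _ fun i _ => Submodule.smul_mem_smul (hd i) trivial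
  have hφ : Function.Surjective φ := by
    intro y
    obtain ⟨v, rfl⟩ := Submodule.mkQ_surjective _ y
    have hv : v ∈ (LinearMap.range E.mulVecLin) ⊔ LinearMap.range α.mulVecLin := by
      rw [htop]; trivial
    obtain ⟨_, ⟨w, rfl⟩, z, hz, rfl⟩ := Submodule.mem_sup.mp hv
    refine ⟨w, ?_⟩
    rw [map_add, (Submodule.Quotient.mk_eq_zero _).mpr hz |> fun t => (t : Submodule.mkQ _ z = 0),
      add_zero]
    rfl
  have hker : LinearMap.ker φ = LinearMap.ker ψ := by
    ext a
    have e1 : a ∈ LinearMap.ker φ ↔ ∃ w, α.mulVec w = E.mulVec a := by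
      rw [LinearMap.mem_ker]
      exact Submodule.Quotient.mk_eq_zero _
    have e2 : a ∈ LinearMap.ker ψ ↔ ∀ j, f ∣ a j := by
      rw [LinearMap.mem_ker, funext_iff]
      refine forall_congr' fun j => ?_
      rw [← Ideal.mem_span_singleton]
      exact Submodule.Quotient.mk_eq_zero _
    rw [e1, e2]
    constructor
    · rintro ⟨w, hw⟩ j
      have h1 : a = f • H.mulVec w := by
        calc a = (H * (β * E)).mulVec a := by rw [hH, Matrix.one_mulVec]
          _ = H.mulVec (β.mulVec (E.mulVec a)) := by simp [Matrix.mulVec_mulVec, Matrix.mul_assoc]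
          _ = f • H.mulVec w := by
            rw [← hw, Matrix.mulVec_mulVec w β α, h', Matrix.smul_mulVec, Matrix.one_mulVec,
              Matrix.mulVec_smul]
      rw [h1]
      exact ⟨_, rfl⟩
    · intro hj
      choose a' ha' using hj
      have : a = f • a' := funext ha'
      refine ⟨β.mulVec (E.mulVec a'), ?_⟩
      rw [Matrix.mulVec_mulVec, h, Matrix.smul_mulVec, Matrix.one_mulVec, this, Matrix.mulVec_smul]
  exact ⟨(φ.quotKerEquivOfSurjective hφ).symm ≪≫ₗ Submodule.quotEquivOfEq _ _ hker ≪≫ₗ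
    ψ.quotKerEquivOfSurjective hψ⟩


/-- A (commutative) local ring `A` is a regular local ring if it is Noetherian and its
maximal ideal can be generated by `dim A` elements, where `dim A` is the Krull dimension. -/
def IsRegularLocalRing' (A : Type*) [CommRing A] [IsLocalRing A] : Prop :=
  IsNoetherianRing A ∧ ∃ s : Finset A,
    Ideal.span (s : Set A) = IsLocalRing.maximalIdeal A ∧
    (s.card : WithBot ℕ∞) = ringKrullDim A

/-- **Local freeness of the cokernel of a Clifford linearization.** Let `A` be a regular
local ring, `f ∈ m_A \ m_A²`, `d ≥ 1`, `N ≥ 1`, and let `α` be an `N × N` matrix over `A`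
with `α ^ d = f • 1`. Then `d ∣ N`, the map `α : A^N → A^N` is injective, its cokernel
`M` is nonzero and annihilated by `f`, and `M`, viewed canonically as a module over
`B = A/(f)`, is free of rank `N / d`. (Since `A → B` is surjective, the `B`-module
structure on `M` restricts to its `A`-structure, so freeness of rank `N/d` over `B` is
expressed by an `A`-linear isomorphism `M ≃ (A/(f))^{N/d}`.) -/
theorem coker_free_of_clifford_relation
    {A : Type*} [CommRing A] [IsLocalRing A] (hreg : IsRegularLocalRing' A)
    (f : A) (hfm : f ∈ IsLocalRing.maximalIdeal A)
    (hfm2 : f ∉ (IsLocalRing.maximalIdeal A) ^ 2)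
    (d N : ℕ) (hd : 1 ≤ d) (hN : 1 ≤ N)
    (α : Matrix (Fin N) (Fin N) A)
    (hα : α ^ d = f • (1 : Matrix (Fin N) (Fin N) A)) :
    d ∣ N ∧ Function.Injective α.mulVecLin ∧
    Nontrivial ((Fin N → A) ⧸ LinearMap.range α.mulVecLin) ∧
    (∀ x : (Fin N → A) ⧸ LinearMap.range α.mulVecLin, f • x = 0) ∧
    Nonempty (((Fin N → A) ⧸ LinearMap.range α.mulVecLin) ≃ₗ[A]
      (Fin (N / d) → A ⧸ Ideal.span {f})) := by
  obtain ⟨hnoeth, s, hs, hcard⟩ := hreg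
  have hdom : IsDomain A := isDomain_of_regular_aux s.card A s hs le_rfl hcard.le
  have hf0 : f ≠ 0 := fun h => hfm2 (h ▸ zero_mem _)
  have h1 : α * α ^ (d - 1) = f • (1 : Matrix (Fin N) (Fin N) A) := by
    rw [← hα, ← pow_succ', Nat.sub_add_cancel hd]
  have h2 : α ^ (d - 1) * α = f • (1 : Matrix (Fin N) (Fin N) A) := by
    rw [← hα, ← pow_succ, Nat.sub_add_cancel hd]
  have hpow : ∀ i, (α.map (residue A)).mulVecLin ^ i = ((α ^ i).map (residue A)).mulVecLin := by
    intro i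
    have := (Matrix.toLin'_pow (α.map (residue A)) i).symm
    rw [← Matrix.map_pow] at this
    exact this
  have hrank : N = d * Module.finrank (ResidueField A)
      (LinearMap.ker (α.map (residue A)).mulVecLin) := by
    rw [← finrank_eq_of_ker_le (α.map (residue A)).mulVecLin d hd]
    · simp
    · rw [hpow, hα]
      ext i j
      simp [Matrix.smul_apply, (residue_eq_zero_iff f).mpr hfm]
    · rw [hpow]
      exact ker_le_range_residue f hfm2 _ _ h2
  have hdiv : N / d = Module.finrank (ResidueField A)
      (LinearMap.ker (α.map (residue A)).mulVecLin) :=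
    Nat.div_eq_of_eq_mul_right hd hrank
  have hdvd : d ∣ N := ⟨_, hrank⟩
  obtain ⟨e⟩ := coker_equiv f hfm2 α (α ^ (d - 1)) h1 h2 (N / d) hdiv.symm
  refine ⟨hdvd, ?_, ?_, ?_, ⟨e⟩⟩
  · rw [← LinearMap.ker_eq_bot, LinearMap.ker_eq_bot']
    intro v hv
    have h3 : f • v = 0 := by
      rw [← Matrix.one_mulVec v, ← Matrix.smul_mulVec, ← h2, ← Matrix.mulVec_mulVec]
      rw [Matrix.mulVecLin_apply] at hv
      rw [hv, Matrix.mulVec_zero]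
    exact (smul_eq_zero.mp h3).resolve_left hf0
  · have hpos : 0 < N / d := Nat.div_pos (Nat.le_of_dvd hN hdvd) hd
    have : Nonempty (Fin (N / d)) := ⟨⟨0, hpos⟩⟩
    have : Nontrivial (A ⧸ Ideal.span {f}) := by
      rw [Ideal.Quotient.nontrivial_iff, Ne, Ideal.span_singleton_eq_top]
      exact hfm
    exact e.toEquiv.nontrivial
  · intro x
    obtain ⟨v, rfl⟩ := Submodule.mkQ_surjective _ x
    rw [← map_smul]
    refine (Submodule.Quotient.mk_eq_zero _).mpr ⟨(α ^ (d - 1)).mulVec v, ?_⟩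
    rw [Matrix.mulVecLin_apply, Matrix.mulVec_mulVec, h1, Matrix.smul_mulVec, Matrix.one_mulVec]
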